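/- arXiv:1806.05127 — 6 statements merged into one kernel-verified Lean document; each statement's English description precedes it below -/
import Mathlib

section
/- Let (Ω, ℱ, P) be a probability space and let A_n, B_n : Ω → ℝ be measurable functions with A_n − B_n → 0 P-almost surely. Fix t ∈ ℝ, define F_n(s) = P(A_n ≤ s) and G_n(s) = P(B_n ≤ s), and assume both families {F_n}_n and {G_n}_n are equicontinuous at t, i.e. for every ε > 0 there is δ > 0 such that |s − t| < δ implies |F_n(s) − F_n(t)| < ε for all n, and likewise for G_n. Then |F_n(t) − G_n(t)| → 0 as n → ∞. -/
open MeasureTheory Filter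

/-- The distribution functions of two random variables are comparable up to a shift by `δ`, at the
cost of the probability that the variables differ by at least `δ`. -/
lemma measureReal_le_add_measureReal_le_norm_sub {Ω : Type*} [MeasurableSpace Ω]
    (P : Measure Ω) [IsFiniteMeasure P] (X Y : Ω → ℝ) (t δ : ℝ) :
    P.real {ω | X ω ≤ t} ≤ P.real {ω | Y ω ≤ t + δ} + P.real {ω | δ ≤ ‖X ω - Y ω‖} := by
  refine (measureReal_mono fun ω (hω : X ω ≤ t) => ?_).trans (measureReal_union_le _ _)
  rcases le_or_gt (Y ω) (t + δ) with h | h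
  · exact Or.inl h
  · refine Or.inr (show δ ≤ ‖X ω - Y ω‖ from ?_)
    rw [Real.norm_eq_abs]
    linarith [neg_le_abs (X ω - Y ω)]

/-- Lemma D.1: if `Aₙ − Bₙ → 0` a.s. and the families of CDFs of `Aₙ` and `Bₙ`
are equicontinuous at `t`, then `|Fₙ(t) − Gₙ(t)| → 0`. -/
theorem cdf_diff_tendsto_zero_of_as_diff_tendsto_zero
    {Ω : Type*} [MeasurableSpace Ω] (P : Measure Ω) [IsProbabilityMeasure P]
    (A B : ℕ → Ω → ℝ) (hA : ∀ n, Measurable (A n)) (hB : ∀ n, Measurable (B n))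
    (has : ∀ᵐ ω ∂P, Tendsto (fun n => A n ω - B n ω) atTop (nhds 0))
    (t : ℝ) (F G : ℕ → ℝ → ℝ)
    (hF : ∀ n s, F n s = (P {ω | A n ω ≤ s}).toReal)
    (hG : ∀ n s, G n s = (P {ω | B n ω ≤ s}).toReal)
    (heqF : ∀ ε > (0 : ℝ), ∃ δ > (0 : ℝ), ∀ n, ∀ s : ℝ, |s - t| < δ → |F n s - F n t| < ε)
    (heqG : ∀ ε > (0 : ℝ), ∃ δ > (0 : ℝ), ∀ n, ∀ s : ℝ, |s - t| < δ → |G n s - G n t| < ε) :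
    Tendsto (fun n => |F n t - G n t|) atTop (nhds 0) := by
  have hmeas : TendstoInMeasure P (fun n ω => A n ω - B n ω) atTop (fun _ => 0) :=
    tendstoInMeasure_of_tendsto_ae
      (fun n => ((hA n).sub (hB n)).aestronglyMeasurable) has
  rw [tendstoInMeasure_iff_measureReal_norm] at hmeas
  simp only [sub_zero] at hmeas
  simp only [← measureReal_def] at hF hG
  rw [Metric.tendsto_atTop]
  intro ε hε
  obtain ⟨δF, hδF, hF'⟩ := heqF (ε / 2) (half_pos hε)
  obtain ⟨δG, hδG, hG'⟩ := heqG (ε / 2) (half_pos hε)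
  obtain ⟨δ, hδ, hδlt⟩ := exists_between (lt_min hδF hδG)
  obtain ⟨N, hN⟩ := Metric.tendsto_atTop.1 (hmeas δ hδ) (ε / 2) (half_pos hε)
  refine ⟨N, fun n hn => ?_⟩
  have hp := hN n hn
  rw [Real.dist_0_eq_abs, abs_of_nonneg measureReal_nonneg] at hp
  have habs : |t + δ - t| = δ := by rw [add_sub_cancel_left, abs_of_pos hδ]
  have hFδ := (abs_lt.1 (hF' n (t + δ) (habs.trans_lt (hδlt.trans_le (min_le_left _ _))))).2
  have hGδ := (abs_lt.1 (hG' n (t + δ) (habs.trans_lt (hδlt.trans_le (min_le_right _ _))))).2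
  have hAB := measureReal_le_add_measureReal_le_norm_sub P (A n) (B n) t δ
  have hBA := measureReal_le_add_measureReal_le_norm_sub P (B n) (A n) t δ
  simp only [norm_sub_rev (B n _)] at hBA
  rw [← hF, ← hG] at hAB
  rw [← hG, ← hF] at hBA
  rw [Real.dist_0_eq_abs, abs_abs, abs_lt]
  constructor <;> linarith
end

section
/- Let M > 0 and let {F_n}_n and {G_n}_n be sequences of continuous cumulative distribution functions on ℝ (monotone nondecreasing, continuous, with F_n(x) = 0 for x ≤ −M and F_n(x) = 1 for x ≥ M, and the same for G_n). Suppose |F_n(t) − G_n(t)| → 0 for every t ∈ ℝ. Define the quantile functions F_n⁻¹(p) = inf{x ∈ ℝ : F_n(x) ≥ p} for p ∈ (0,1), and similarly G_n⁻¹. Assume that for every p ∈ (0,1) both families {F_n⁻¹}_n and {G_n⁻¹}_n are equicontinuous at p. Then for every p ∈ (0,1), |F_n⁻¹(p) − G_n⁻¹(p)| → 0 as n → ∞. -/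
open Filter Set

/-- A point where `f` reaches a positive level `p` bounds the `p`-quantile from above. -/
lemma sInf_level_le {f : ℝ → ℝ} {a p x : ℝ} (hf0 : ∀ x ≤ a, f x = 0) (hp : 0 < p)
    (hx : p ≤ f x) : sInf {x : ℝ | p ≤ f x} ≤ x := by
  refine csInf_le ⟨a, fun y (hy : p ≤ f y) => ?_⟩ hx
  by_contra! h
  linarith [hf0 y h.le]

/-- For a continuous `f` the infimum defining the `p`-quantile is attained. -/
lemma sInf_level_mem {f : ℝ → ℝ} {a b p : ℝ} (hf : Continuous f) (hf0 : ∀ x ≤ a, f x = 0)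
    (hf1 : ∀ x, b ≤ x → f x = 1) (hp : p ∈ Ioo (0 : ℝ) 1) :
    p ≤ f (sInf {x : ℝ | p ≤ f x}) := by
  have hclosed : IsClosed {x : ℝ | p ≤ f x} := isClosed_le continuous_const hf
  refine hclosed.csInf_mem ⟨b, ?_⟩ ⟨a, fun y (hy : p ≤ f y) => ?_⟩
  · simpa [hf1 b le_rfl] using hp.2.le
  · by_contra! h
    linarith [hf0 y h.le, hp.1]

/-- One-sided comparison of quantiles: if `F n - G n → 0` pointwise and the quantiles of `G n`
are equicontinuous at `p`, they eventually exceed those of `F n` by less than `ε`. -/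
lemma eventually_quantile_lt_add {ι : Type*} {l : Filter ι} {a b p ε : ℝ} {F G : ι → ℝ → ℝ}
    (hFmono : ∀ n, Monotone (F n)) (hFcont : ∀ n, Continuous (F n))
    (hF0 : ∀ n, ∀ x ≤ a, F n x = 0) (hF1 : ∀ n, ∀ x, b ≤ x → F n x = 1)
    (hG0 : ∀ n, ∀ x ≤ a, G n x = 0)
    (hconv : ∀ t : ℝ, Tendsto (fun n => |F n t - G n t|) l (nhds 0))
    (hp : p ∈ Ioo (0 : ℝ) 1)
    (heqG : ∀ ε > (0 : ℝ), ∃ δ > (0 : ℝ), ∀ n, ∀ q ∈ Ioo (0 : ℝ) 1, |q - p| < δ →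
      |sInf {x : ℝ | q ≤ G n x} - sInf {x : ℝ | p ≤ G n x}| < ε)
    (hε : 0 < ε) :
    ∀ᶠ n in l, sInf {x : ℝ | p ≤ G n x} < sInf {x : ℝ | p ≤ F n x} + ε := by
  obtain ⟨δ, hδ, hG⟩ := heqG (ε / 2) (half_pos hε)
  obtain ⟨η, hη, hηlt⟩ := exists_between (lt_min hδ hp.1)
  obtain ⟨hηδ, hηp⟩ := lt_min_iff.1 hηlt
  obtain ⟨s, -, hs, hcover⟩ :=
    (isCompact_Icc (a := a) (b := b)).finite_cover_balls (by positivity : 0 < ε / 4)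
  have hgrid : ∀ᶠ n in l, ∀ y ∈ s, |F n (y + ε / 4) - G n (y + ε / 4)| < η :=
    (eventually_all_finite hs).2 fun y _ => (hconv _).eventually_lt_const hη
  filter_upwards [hgrid] with n hn
  have hmem := sInf_level_mem (hFcont n) (hF0 n) (hF1 n) hp
  have hle : sInf {x : ℝ | p ≤ F n x} ≤ b :=
    sInf_level_le (hF0 n) hp.1 (by simpa [hF1 n b le_rfl] using hp.2.le)
  set x := sInf {x : ℝ | p ≤ F n x}
  have hge : a ≤ x := by
    by_contra! h
    linarith [hF0 n x h.le, hp.1]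
  obtain ⟨y, hy, hxy⟩ := mem_iUnion₂.1 (hcover ⟨hge, hle⟩)
  rw [Metric.mem_ball, Real.dist_eq, abs_lt] at hxy
  have hFy : F n x ≤ F n (y + ε / 4) := hFmono n (by linarith)
  have hGy : p - η ≤ G n (y + ε / 4) := by linarith [(abs_lt.1 (hn y hy)).2]
  have hquantile := sInf_level_le (hG0 n) (sub_pos.2 hηp) hGy
  have hclose := hG n (p - η) ⟨sub_pos.2 hηp, by linarith [hp.2]⟩
    (by rw [sub_sub_cancel_left, abs_neg, abs_of_pos hη]; exact hηδ)
  linarith [(abs_lt.1 hclose).1]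

/-- Lemma D.2: pointwise convergence to zero of differences of continuous,
compactly supported CDFs transfers to their quantile functions, under
equicontinuity of the quantile families at every `p ∈ (0,1)`. -/
theorem quantile_diff_tendsto_zero
    (M : ℝ) (hM : 0 < M) (F G : ℕ → ℝ → ℝ)
    (hFmono : ∀ n, Monotone (F n)) (hFcont : ∀ n, Continuous (F n))
    (hF0 : ∀ n, ∀ x : ℝ, x ≤ -M → F n x = 0) (hF1 : ∀ n, ∀ x : ℝ, M ≤ x → F n x = 1)
    (hGmono : ∀ n, Monotone (G n)) (hGcont : ∀ n, Continuous (G n))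
    (hG0 : ∀ n, ∀ x : ℝ, x ≤ -M → G n x = 0) (hG1 : ∀ n, ∀ x : ℝ, M ≤ x → G n x = 1)
    (hconv : ∀ t : ℝ, Tendsto (fun n => |F n t - G n t|) atTop (nhds 0))
    (Finv Ginv : ℕ → ℝ → ℝ)
    (hFinv : ∀ n, ∀ p : ℝ, Finv n p = sInf {x : ℝ | p ≤ F n x})
    (hGinv : ∀ n, ∀ p : ℝ, Ginv n p = sInf {x : ℝ | p ≤ G n x})
    (heqF : ∀ p ∈ Ioo (0 : ℝ) 1, ∀ ε > (0 : ℝ), ∃ δ > (0 : ℝ),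
      ∀ n, ∀ q ∈ Ioo (0 : ℝ) 1, |q - p| < δ → |Finv n q - Finv n p| < ε)
    (heqG : ∀ p ∈ Ioo (0 : ℝ) 1, ∀ ε > (0 : ℝ), ∃ δ > (0 : ℝ),
      ∀ n, ∀ q ∈ Ioo (0 : ℝ) 1, |q - p| < δ → |Ginv n q - Ginv n p| < ε) :
    ∀ p ∈ Ioo (0 : ℝ) 1, Tendsto (fun n => |Finv n p - Ginv n p|) atTop (nhds 0) := by
  intro p hp
  simp only [hFinv] at heqF
  simp only [hGinv] at heqG
  simp only [hFinv, hGinv]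
  refine tendsto_order.2 ⟨fun ε hε => Eventually.of_forall fun n => hε.trans_le (abs_nonneg _),
    fun ε hε => ?_⟩
  have hconv' : ∀ t : ℝ, Tendsto (fun n => |G n t - F n t|) atTop (nhds 0) := by
    simpa only [abs_sub_comm] using hconv
  filter_upwards [eventually_quantile_lt_add hFmono hFcont hF0 hF1 hG0 hconv hp (heqG p hp) hε,
    eventually_quantile_lt_add hGmono hGcont hG0 hG1 hF0 hconv' hp (heqF p hp) hε] with n hGF hFG
  exact abs_sub_lt_iff.2 ⟨by linarith, by linarith⟩
end

section
/- Let δ > 0 and let ([a_n, b_n])_n be a sequence of closed subintervals of [0,1] with b_n − a_n ≥ δ for all n, which is Cauchy with respect to the pseudometric (I, J) ↦ λ(I Δ J), where λ is Lebesgue measure. Then the sequences (a_n) and (b_n) converge in ℝ to limits a and b with b − a ≥ δ, and λ([a_n, b_n] Δ [a, b]) → 0 as n → ∞. -/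
open MeasureTheory Set Filter

/-- A point in exactly one of two closed intervals lies between the two left endpoints or between
the two right endpoints. -/
lemma symmDiff_Icc_subset_uIcc_union (a b c d : ℝ) :
    symmDiff (Icc a b) (Icc c d) ⊆ uIcc a c ∪ uIcc b d := by
  intro x hx
  simp only [Set.mem_symmDiff, mem_Icc, mem_union, mem_uIcc] at hx ⊢
  grind

lemma volume_symmDiff_Icc_ne_top (a b c d : ℝ) :
    volume (symmDiff (Icc a b) (Icc c d)) ≠ ⊤ :=
  measure_ne_top_of_subset (symmDiff_Icc_subset_uIcc_union a b c d)
    (measure_union_ne_top isCompact_uIcc.measure_ne_top isCompact_uIcc.measure_ne_top)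

lemma volume_real_symmDiff_Icc_le (a b c d : ℝ) :
    volume.real (symmDiff (Icc a b) (Icc c d)) ≤ |a - c| + |b - d| := by
  calc volume.real (symmDiff (Icc a b) (Icc c d))
      ≤ volume.real (uIcc a c ∪ uIcc b d) :=
        measureReal_mono (symmDiff_Icc_subset_uIcc_union a b c d)
          (measure_union_ne_top isCompact_uIcc.measure_ne_top isCompact_uIcc.measure_ne_top)
    _ ≤ volume.real (uIcc a c) + volume.real (uIcc b d) := measureReal_union_le _ _
    _ = |a - c| + |b - d| := by
        simp [measureReal_def, abs_sub_comm]

lemma min_abs_sub_left_le_volume_real_symmDiff_Icc {δ a b c d : ℝ}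
    (hab : δ ≤ b - a) (hcd : δ ≤ d - c) :
    min δ |a - c| ≤ volume.real (symmDiff (Icc a b) (Icc c d)) := by
  wlog hac : a ≤ c generalizing a b c d
  · rw [abs_sub_comm, symmDiff_comm]
    exact this hcd hab (le_of_not_ge hac)
  have hsub : Ico a (min c (a + δ)) ⊆ symmDiff (Icc a b) (Icc c d) := by
    intro x hx
    simp only [Set.mem_symmDiff, mem_Icc, mem_Ico, lt_min_iff] at hx ⊢
    grind
  calc min δ |a - c| ≤ min c (a + δ) - a := by
        rw [abs_sub_comm, abs_of_nonneg (sub_nonneg.2 hac)]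
        grind
    _ ≤ volume.real (Ico a (min c (a + δ))) := by
        rw [Real.volume_real_Ico]
        exact le_max_left _ _
    _ ≤ _ := measureReal_mono hsub (volume_symmDiff_Icc_ne_top a b c d)

lemma min_abs_sub_right_le_volume_real_symmDiff_Icc {δ a b c d : ℝ}
    (hab : δ ≤ b - a) (hcd : δ ≤ d - c) :
    min δ |b - d| ≤ volume.real (symmDiff (Icc a b) (Icc c d)) := by
  wlog hdb : d ≤ b generalizing a b c d
  · rw [abs_sub_comm, symmDiff_comm]
    exact this hcd hab (le_of_not_ge hdb)
  have hsub : Ioc (max d (b - δ)) b ⊆ symmDiff (Icc a b) (Icc c d) := by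
    intro x hx
    simp only [Set.mem_symmDiff, mem_Icc, mem_Ioc, max_lt_iff] at hx ⊢
    grind
  calc min δ |b - d| ≤ b - max d (b - δ) := by
        rw [abs_of_nonneg (sub_nonneg.2 hdb)]
        grind
    _ ≤ volume.real (Ioc (max d (b - δ)) b) := by
        rw [Real.volume_real_Ioc]
        exact le_max_left _ _
    _ ≤ _ := measureReal_mono hsub (volume_symmDiff_Icc_ne_top a b c d)

/-- A real sequence is Cauchy if its distances, truncated at some `δ > 0`, are dominated by a
quantity that becomes arbitrarily small. -/
lemma cauchySeq_of_min_abs_sub_le {δ : ℝ} (hδ : 0 < δ) {u : ℕ → ℝ} {D : ℕ → ℕ → ℝ}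
    (hu : ∀ m n, min δ |u m - u n| ≤ D m n)
    (hD : ∀ ε > (0 : ℝ), ∃ N : ℕ, ∀ m ≥ N, ∀ n ≥ N, D m n < ε) : CauchySeq u := by
  refine Metric.cauchySeq_iff.2 fun ε hε => ?_
  obtain ⟨N, hN⟩ := hD (min δ ε) (lt_min hδ hε)
  refine ⟨N, fun m hm n hn => ?_⟩
  have h := (hu m n).trans_lt (hN m hm n hn)
  rw [Real.dist_eq]
  grind

/-- One-dimensional completeness argument from Lemma B.2: a sequence of closed
subintervals of `[0,1]` of length at least `δ` that is Cauchy in the Lebesgue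
symmetric-difference pseudometric converges to a closed interval of length at
least `δ`. -/
theorem interval_limit_of_symmDiff_cauchy
    (δ : ℝ) (hδ : 0 < δ) (a b : ℕ → ℝ)
    (hsub : ∀ n, 0 ≤ a n ∧ b n ≤ 1)
    (hlen : ∀ n, δ ≤ b n - a n)
    (hcauchy : ∀ ε > (0 : ℝ), ∃ N : ℕ, ∀ m ≥ N, ∀ n ≥ N,
      (volume (symmDiff (Icc (a m) (b m)) (Icc (a n) (b n)))).toReal < ε) :
    ∃ aLim bLim : ℝ,
      Tendsto a atTop (nhds aLim) ∧ Tendsto b atTop (nhds bLim) ∧ δ ≤ bLim - aLim ∧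
      Tendsto (fun n => (volume (symmDiff (Icc (a n) (b n)) (Icc aLim bLim))).toReal)
        atTop (nhds 0) := by
  obtain ⟨aLim, ha⟩ := cauchySeq_tendsto_of_complete <| cauchySeq_of_min_abs_sub_le hδ
    (fun m n => min_abs_sub_left_le_volume_real_symmDiff_Icc (hlen m) (hlen n)) hcauchy
  obtain ⟨bLim, hb⟩ := cauchySeq_tendsto_of_complete <| cauchySeq_of_min_abs_sub_le hδ
    (fun m n => min_abs_sub_right_le_volume_real_symmDiff_Icc (hlen m) (hlen n)) hcauchy
  refine ⟨aLim, bLim, ha, hb, ge_of_tendsto' (hb.sub ha) hlen, ?_⟩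
  have hbound : Tendsto (fun n => |a n - aLim| + |b n - bLim|) atTop (nhds 0) := by
    simpa using (ha.sub_const aLim).abs.add (hb.sub_const bLim).abs
  exact squeeze_zero (fun _ => ENNReal.toReal_nonneg)
    (fun n => volume_real_symmDiff_Icc_le (a n) (b n) aLim bLim) hbound
end

section
/- Let δ > 0 and let (Γ_n)_n be a sequence of closed boxes Γ_n = ∏_{j=1}^d [a_{jn}, b_{jn}] ⊆ [0,1]^d with d-dimensional Lebesgue measure λ_d(Γ_n) ≥ δ for all n, which is Cauchy with respect to the pseudometric (A, B) ↦ λ_d(A Δ B). Then for each j the sequences (a_{jn})_n and (b_{jn})_n converge to limits a_j and b_j, and the box Γ = ∏_{j=1}^d [a_j, b_j] satisfies λ_d(Γ_n Δ Γ) → 0 as n → ∞. -/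
open MeasureTheory Set Filter

/-- The volume of a closed box, as the product of the (truncated) side lengths. -/
lemma volume_real_pi_Icc {ι : Type*} [Fintype ι] (a b : ι → ℝ) :
    volume.real (univ.pi fun j => Icc (a j) (b j)) = ∏ j, max (b j - a j) 0 := by
  simp only [measureReal_def, volume_pi_pi, ENNReal.toReal_prod, Real.volume_Icc,
    ENNReal.toReal_ofReal']

lemma volume_pi_Icc_ne_top {ι : Type*} [Fintype ι] (a b : ι → ℝ) :
    volume (univ.pi fun j => Icc (a j) (b j)) ≠ ⊤ :=
  (isCompact_univ_pi fun _ => isCompact_Icc).measure_ne_top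

/-- If an interval `Ioo p q` inside the `j`-th side of a box `A` of volume at least `δ` misses the
`j`-th side of a box `B`, then it contributes at least `δ * (q - p)` to the volume of `A ∆ B`. -/
lemma mul_sub_le_volume_real_symmDiff {ι : Type*} [Fintype ι] {a b a' b' : ι → ℝ} {δ p q : ℝ}
    {j : ι} (hsub : 0 ≤ a j ∧ b j ≤ 1) (hvol : δ ≤ volume.real (univ.pi fun i => Icc (a i) (b i)))
    (hpq : p ≤ q) (hI : Ioo p q ⊆ Icc (a j) (b j)) (hd : Disjoint (Ioo p q) (Icc (a' j) (b' j))) :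
    δ * (q - p) ≤ volume.real (symmDiff (univ.pi fun i => Icc (a i) (b i))
      (univ.pi fun i => Icc (a' i) (b' i))) := by
  classical
  let S : Set (ι → ℝ) := univ.pi (Function.update (fun i => Icc (a i) (b i)) j (Ioo p q))
  have hS : S ⊆ symmDiff (univ.pi fun i => Icc (a i) (b i))
      (univ.pi fun i => Icc (a' i) (b' i)) := by
    intro x hx
    have hxj : x j ∈ Ioo p q := by simpa using hx j (mem_univ j)
    refine Or.inl ⟨fun i _ => ?_, fun h => disjoint_left.1 hd hxj (h j (mem_univ j))⟩
    by_cases hij : i = j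
    · subst hij
      exact hI hxj
    · simpa [hij] using hx i (mem_univ i)
  have hSvol : volume.real S = (q - p) * ∏ i ∈ Finset.univ.erase j, max (b i - a i) 0 := by
    rw [measureReal_def, volume_pi_pi, ENNReal.toReal_prod,
      ← Finset.mul_prod_erase _ _ (Finset.mem_univ j)]
    congr 1
    · simp [hpq]
    · refine Finset.prod_congr rfl fun i hi => ?_
      simp [Finset.ne_of_mem_erase hi, ENNReal.toReal_ofReal']
  have hδ : δ ≤ ∏ i ∈ Finset.univ.erase j, max (b i - a i) 0 := by
    rw [volume_real_pi_Icc, ← Finset.mul_prod_erase _ _ (Finset.mem_univ j)] at hvol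
    exact hvol.trans (mul_le_of_le_one_left (Finset.prod_nonneg fun i _ => le_max_right _ _)
      (max_le (by linarith) zero_le_one))
  calc δ * (q - p) ≤ volume.real S := by
        rw [hSvol, mul_comm]
        exact mul_le_mul_of_nonneg_left hδ (sub_nonneg.2 hpq)
    _ ≤ _ := measureReal_mono hS
        (measure_symmDiff_ne_top (volume_pi_Icc_ne_top _ _) (volume_pi_Icc_ne_top _ _))

/-- Two boxes with disjoint `j`-th sides have symmetric difference at least as large as either. -/
lemma le_volume_real_symmDiff_of_disjoint {ι : Type*} [Fintype ι] {a b a' b' : ι → ℝ} {δ : ℝ}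
    {j : ι} (hvol : δ ≤ volume.real (univ.pi fun i => Icc (a i) (b i)))
    (hd : Disjoint (Icc (a j) (b j)) (Icc (a' j) (b' j))) :
    δ ≤ volume.real (symmDiff (univ.pi fun i => Icc (a i) (b i))
      (univ.pi fun i => Icc (a' i) (b' i))) :=
  hvol.trans <| measureReal_mono
    (fun _ hx => Or.inl ⟨hx, fun h => disjoint_left.1 hd (hx j (mem_univ j)) (h j (mem_univ j))⟩)
    (measure_symmDiff_ne_top (volume_pi_Icc_ne_top _ _) (volume_pi_Icc_ne_top _ _))

/-- One-sided control of the endpoints of two boxes by their symmetric difference. -/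
lemma endpoints_sub_lt_of_volume_real_symmDiff_lt {ι : Type*} [Fintype ι] {a b a' b' : ι → ℝ}
    {δ ε : ℝ} {j : ι} (hδ : 0 < δ) (hε : 0 < ε) (hsub : 0 ≤ a j ∧ b j ≤ 1)
    (hvol : δ ≤ volume.real (univ.pi fun i => Icc (a i) (b i)))
    (h : volume.real (symmDiff (univ.pi fun i => Icc (a i) (b i))
      (univ.pi fun i => Icc (a' i) (b' i))) < δ * min ε 1) :
    a' j - a j < ε ∧ b j - b' j < ε := by
  have hlt : volume.real (symmDiff (univ.pi fun i => Icc (a i) (b i))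
      (univ.pi fun i => Icc (a' i) (b' i))) < δ :=
    h.trans_le (mul_le_of_le_one_right hδ.le (min_le_right _ _))
  have hltε := h.trans_le (mul_le_mul_of_nonneg_left (min_le_left ε 1) hδ.le)
  constructor <;> by_contra! hge
  · rcases le_or_gt (a' j) (b j) with hle | hgt
    · have := mul_sub_le_volume_real_symmDiff (a' := a') (b' := b') (p := a j) (q := a' j)
        hsub hvol (by linarith) (fun x hx => ⟨hx.1.le, hx.2.le.trans hle⟩)
        (disjoint_left.2 fun x hx hx' => hx.2.not_ge hx'.1)
      nlinarith
    · exact hlt.not_ge (le_volume_real_symmDiff_of_disjoint hvol (j := j)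
        (disjoint_left.2 fun x hx hx' => (hx.2.trans_lt hgt).not_ge hx'.1))
  · rcases le_or_gt (a j) (b' j) with hle | hgt
    · have := mul_sub_le_volume_real_symmDiff (a' := a') (b' := b') (p := b' j) (q := b j)
        hsub hvol (by linarith) (fun x hx => ⟨hle.trans hx.1.le, hx.2.le⟩)
        (disjoint_left.2 fun x hx hx' => hx.1.not_ge hx'.2)
      nlinarith
    · exact hlt.not_ge (le_volume_real_symmDiff_of_disjoint hvol (j := j)
        (disjoint_left.2 fun x hx hx' => (hgt.trans_le hx.1).not_ge hx'.2))

lemma volume_real_symmDiff_pi_Icc {ι : Type*} [Fintype ι] (a b a' b' : ι → ℝ) :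
    volume.real (symmDiff (univ.pi fun j => Icc (a j) (b j)) (univ.pi fun j => Icc (a' j) (b' j)))
      = ∏ j, max (b j - a j) 0 + ∏ j, max (b' j - a' j) 0
        - 2 * ∏ j, max (min (b j) (b' j) - max (a j) (a' j)) 0 := by
  have hm (a b : ι → ℝ) : MeasurableSet (univ.pi fun j => Icc (a j) (b j)) :=
    .univ_pi fun _ => measurableSet_Icc
  have hinter : (univ.pi fun j => Icc (a j) (b j)) ∩ (univ.pi fun j => Icc (a' j) (b' j)) =
      univ.pi fun j => Icc (max (a j) (a' j)) (min (b j) (b' j)) := by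
    simp only [← pi_inter_distrib, Icc_inter_Icc]
  have h₁ := measureReal_inter_add_sdiff (μ := volume) (s := univ.pi fun j => Icc (a j) (b j))
    (hm a' b') (volume_pi_Icc_ne_top a b)
  have h₂ := measureReal_inter_add_sdiff (μ := volume) (s := univ.pi fun j => Icc (a' j) (b' j))
    (hm a b) (volume_pi_Icc_ne_top a' b')
  rw [inter_comm] at h₂
  rw [hinter] at h₁ h₂
  rw [measureReal_symmDiff_eq (hm a b) (hm a' b')
    (volume_pi_Icc_ne_top a b) (volume_pi_Icc_ne_top a' b')]
  simp only [volume_real_pi_Icc] at h₁ h₂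
  linarith

/-- Boxes depend continuously on their endpoints in the symmetric-difference pseudometric. -/
lemma tendsto_volume_real_symmDiff_pi_Icc {ι α : Type*} [Fintype ι] {l : Filter α}
    {a b : α → ι → ℝ} {a' b' : ι → ℝ} (ha : ∀ j, Tendsto (fun n => a n j) l (nhds (a' j)))
    (hb : ∀ j, Tendsto (fun n => b n j) l (nhds (b' j))) :
    Tendsto (fun n => volume.real (symmDiff (univ.pi fun j => Icc (a n j) (b n j))
      (univ.pi fun j => Icc (a' j) (b' j)))) l (nhds 0) := by
  simp only [volume_real_symmDiff_pi_Icc]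
  have h₁ : Tendsto (fun n => ∏ j, max (b n j - a n j) 0) l (nhds (∏ j, max (b' j - a' j) 0)) :=
    tendsto_finsetProd _ fun j _ => ((hb j).sub (ha j)).max tendsto_const_nhds
  have h₂ : Tendsto (fun n => ∏ j, max (min (b n j) (b' j) - max (a n j) (a' j)) 0) l
      (nhds (∏ j, max (min (b' j) (b' j) - max (a' j) (a' j)) 0)) :=
    tendsto_finsetProd _ fun j _ => (((hb j).min tendsto_const_nhds).sub
      ((ha j).max tendsto_const_nhds)).max tendsto_const_nhds
  convert (h₁.add_const (∏ j, max (b' j - a' j) 0)).sub (h₂.const_mul 2) using 2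
  simp only [min_self, max_self]
  ring

/-- Lemma B.2: a sequence of closed boxes in `[0,1]^d` of Lebesgue measure at
least `δ` that is Cauchy in the Lebesgue symmetric-difference pseudometric has
coordinatewise convergent endpoints, and converges in the pseudometric to the
limiting box. -/
theorem box_limit_of_symmDiff_cauchy
    (d : ℕ) (δ : ℝ) (hδ : 0 < δ) (a b : ℕ → Fin d → ℝ)
    (hsub : ∀ n j, 0 ≤ a n j ∧ b n j ≤ 1)
    (hvol : ∀ n, δ ≤ (volume (univ.pi fun j => Icc (a n j) (b n j))).toReal)
    (hcauchy : ∀ ε > (0 : ℝ), ∃ N : ℕ, ∀ m ≥ N, ∀ n ≥ N,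
      (volume (symmDiff (univ.pi fun j => Icc (a m j) (b m j))
        (univ.pi fun j => Icc (a n j) (b n j)))).toReal < ε) :
    ∃ aLim bLim : Fin d → ℝ,
      (∀ j, Tendsto (fun n => a n j) atTop (nhds (aLim j))) ∧
      (∀ j, Tendsto (fun n => b n j) atTop (nhds (bLim j))) ∧
      Tendsto (fun n => (volume (symmDiff (univ.pi fun j => Icc (a n j) (b n j))
        (univ.pi fun j => Icc (aLim j) (bLim j)))).toReal) atTop (nhds 0) := by
  have hclose (ε : ℝ) (hε : 0 < ε) : ∃ N : ℕ, ∀ m ≥ N, ∀ n ≥ N, ∀ j,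
      a n j - a m j < ε ∧ b m j - b n j < ε := by
    obtain ⟨N, hN⟩ := hcauchy (δ * min ε 1) (by positivity)
    exact ⟨N, fun m hm n hn j => endpoints_sub_lt_of_volume_real_symmDiff_lt hδ hε (hsub m j)
      (hvol m) (hN m hm n hn)⟩
  have ha (j : Fin d) : ∃ x, Tendsto (fun n => a n j) atTop (nhds x) := by
    refine cauchySeq_tendsto_of_complete (Metric.cauchySeq_iff.2 fun ε hε => ?_)
    obtain ⟨N, hN⟩ := hclose ε hε
    exact ⟨N, fun m hm n hn => abs_sub_lt_iff.2 ⟨(hN n hn m hm j).1, (hN m hm n hn j).1⟩⟩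
  have hb (j : Fin d) : ∃ x, Tendsto (fun n => b n j) atTop (nhds x) := by
    refine cauchySeq_tendsto_of_complete (Metric.cauchySeq_iff.2 fun ε hε => ?_)
    obtain ⟨N, hN⟩ := hclose ε hε
    exact ⟨N, fun m hm n hn => abs_sub_lt_iff.2 ⟨(hN m hm n hn j).2, (hN n hn m hm j).2⟩⟩
  choose aLim haLim using ha
  choose bLim hbLim using hb
  exact ⟨aLim, bLim, haLim, hbLim, tendsto_volume_real_symmDiff_pi_Icc haLim hbLim⟩
end

section
/- Let μ be a finite Borel measure on [0,1]^d such that μ(A) ≤ C·λ_d(A) for every Borel set A, where λ_d is Lebesgue measure and C > 0. Then the collection ℬ of all closed boxes ∏_{j=1}^d [a_j, b_j] ⊆ [0,1]^d is totally bounded with respect to the pseudometric (A, B) ↦ μ(A Δ B): for every ε > 0 there exists a finite collection of closed boxes B₁,…,B_N ⊆ [0,1]^d such that every closed box B ⊆ [0,1]^d satisfies μ(B Δ B_i) < ε for some i. -/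
open MeasureTheory Set

/-- The part of the unit cube where the `j`-th coordinate is within `δ` of `c`. -/
def cubeSlab {d : ℕ} (j : Fin d) (c δ : ℝ) : Set (Fin d → ℝ) :=
  univ.pi (Function.update (fun _ => Icc (0 : ℝ) 1) j (Metric.closedBall c δ))

lemma mem_cubeSlab {d : ℕ} {j : Fin d} {c δ : ℝ} {x : Fin d → ℝ}
    (hx : x ∈ univ.pi fun _ : Fin d => Icc (0 : ℝ) 1) (hj : |x j - c| ≤ δ) :
    x ∈ cubeSlab j c δ := by
  intro k _
  rcases eq_or_ne k j with rfl | hk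
  · simpa [Real.dist_eq] using hj
  · simpa [Function.update_of_ne hk] using hx k (mem_univ k)

lemma volume_cubeSlab {d : ℕ} (j : Fin d) (c δ : ℝ) :
    volume (cubeSlab j c δ) = ENNReal.ofReal (2 * δ) := by
  rw [cubeSlab, volume_pi_pi, Finset.prod_eq_single j]
  · simp
  · intro k _ hk
    simp [Function.update_of_ne hk]
  · simp

lemma pi_Icc_diff_subset_iUnion_cubeSlab {d : ℕ} {a b a' b' : Fin d → ℝ} {δ : ℝ}
    (hab : (univ.pi fun j => Icc (a j) (b j)) ⊆ univ.pi fun _ => Icc (0 : ℝ) 1)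
    (ha : ∀ j, |a j - a' j| ≤ δ) (hb : ∀ j, |b j - b' j| ≤ δ) :
    (univ.pi fun j => Icc (a j) (b j)) \ (univ.pi fun j => Icc (a' j) (b' j)) ⊆
      ⋃ j, cubeSlab j (a' j) δ ∪ cubeSlab j (b' j) δ := by
  rintro x ⟨hx, hx'⟩
  simp only [mem_univ_pi, not_forall] at hx'
  obtain ⟨j, hj⟩ := hx'
  obtain ⟨hxa, hxb⟩ := hx j (mem_univ j)
  refine mem_iUnion.2 ⟨j, ?_⟩
  by_cases h : a' j ≤ x j
  · have h' : b' j < x j := not_le.1 fun h' => hj ⟨h, h'⟩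
    refine Or.inr (mem_cubeSlab (hab hx) ?_)
    have := abs_le.1 (hb j)
    exact abs_le.2 ⟨by linarith, by linarith⟩
  · refine Or.inl (mem_cubeSlab (hab hx) ?_)
    have := abs_le.1 (ha j)
    exact abs_le.2 ⟨by linarith, by linarith⟩

lemma pi_Icc_subset_unitCube {d : ℕ} {a b : Fin d → ℝ} (ha : 0 ≤ a) (hb : b ≤ 1) :
    (univ.pi fun j => Icc (a j) (b j)) ⊆ univ.pi fun _ => Icc (0 : ℝ) 1 :=
  pi_mono fun j _ => Icc_subset_Icc (ha j) (hb j)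

/-- Boxes with nearby endpoints in the unit cube differ by a set of small volume. -/
lemma volume_symmDiff_pi_Icc_le {d : ℕ} {a b a' b' : Fin d → ℝ} {δ : ℝ} (hδ : 0 ≤ δ)
    (hab : (univ.pi fun j => Icc (a j) (b j)) ⊆ univ.pi fun _ => Icc (0 : ℝ) 1)
    (hab' : (univ.pi fun j => Icc (a' j) (b' j)) ⊆ univ.pi fun _ => Icc (0 : ℝ) 1)
    (ha : ∀ j, |a j - a' j| ≤ δ) (hb : ∀ j, |b j - b' j| ≤ δ) :
    volume (symmDiff (univ.pi fun j => Icc (a j) (b j)) (univ.pi fun j => Icc (a' j) (b' j))) ≤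
      ENNReal.ofReal (8 * d * δ) := by
  have key : ∀ c e : Fin d → ℝ,
      volume (⋃ j, cubeSlab j (c j) δ ∪ cubeSlab j (e j) δ) ≤ ENNReal.ofReal (4 * d * δ) := by
    intro c e
    calc volume (⋃ j, cubeSlab j (c j) δ ∪ cubeSlab j (e j) δ)
        ≤ ∑ j, volume (cubeSlab j (c j) δ ∪ cubeSlab j (e j) δ) := measure_iUnion_fintype_le _ _
      _ ≤ ∑ _j : Fin d, ENNReal.ofReal (4 * δ) := by
          refine Finset.sum_le_sum fun j _ => (measure_union_le _ _).trans_eq ?_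
          rw [volume_cubeSlab, volume_cubeSlab, ← ENNReal.ofReal_add (by positivity) (by positivity)]
          ring_nf
      _ = ENNReal.ofReal (4 * d * δ) := by
          rw [← ENNReal.ofReal_sum_of_nonneg fun _ _ => by positivity]
          simp only [Finset.sum_const, Finset.card_univ, Fintype.card_fin, nsmul_eq_mul]
          ring_nf
  have hdiff := (measure_mono (pi_Icc_diff_subset_iUnion_cubeSlab hab ha hb)).trans (key a' b')
  have hdiff' := (measure_mono (pi_Icc_diff_subset_iUnion_cubeSlab hab'
    (fun j => abs_sub_comm (a j) (a' j) ▸ ha j)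
    (fun j => abs_sub_comm (b j) (b' j) ▸ hb j))).trans (key a b)
  refine (measure_union_le _ _).trans ((add_le_add hdiff hdiff').trans_eq ?_)
  rw [← ENNReal.ofReal_add (by positivity) (by positivity)]
  ring_nf

/-- Every closed box inside the unit cube, empty ones included, has endpoints in the unit cube. -/
lemma exists_endpoints_mem_Icc {d : ℕ} {a b : Fin d → ℝ}
    (hab : (univ.pi fun j => Icc (a j) (b j)) ⊆ univ.pi fun _ => Icc (0 : ℝ) 1) :
    ∃ a₁ ∈ Icc (0 : Fin d → ℝ) 1, ∃ b₁ ∈ Icc (0 : Fin d → ℝ) 1,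
      (univ.pi fun j => Icc (a j) (b j)) = univ.pi fun j => Icc (a₁ j) (b₁ j) := by
  by_cases h : a ≤ b
  · have ha := hab (show a ∈ univ.pi fun j => Icc (a j) (b j) from fun j _ => ⟨le_rfl, h j⟩)
    have hb := hab (show b ∈ univ.pi fun j => Icc (a j) (b j) from fun j _ => ⟨h j, le_rfl⟩)
    exact ⟨a, ⟨fun j => (ha j trivial).1, fun j => (ha j trivial).2⟩,
      b, ⟨fun j => (hb j trivial).1, fun j => (hb j trivial).2⟩, rfl⟩
  · obtain ⟨j, hj⟩ := not_forall.1 h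
    refine ⟨1, ⟨zero_le_one, le_rfl⟩, 0, ⟨le_rfl, zero_le_one⟩, ?_⟩
    exact (univ_pi_eq_empty (t := fun j => Icc (a j) (b j)) (Icc_eq_empty hj)).trans
      (univ_pi_eq_empty (i := j) (by simp)).symm

/-- Lemma B.3: if `μ` is a finite Borel measure on `ℝ^d` dominated by `C` times
Lebesgue measure, then the collection of closed boxes contained in `[0,1]^d` is
totally bounded in the `μ`-symmetric-difference pseudometric. -/
theorem boxes_totallyBounded_symmDiff
    (d : ℕ) (μ : Measure (Fin d → ℝ)) [IsFiniteMeasure μ]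
    (C : ℝ) (hC : 0 < C)
    (hdom : ∀ A : Set (Fin d → ℝ), MeasurableSet A → μ A ≤ ENNReal.ofReal C * volume A) :
    ∀ ε > (0 : ℝ), ∃ (N : ℕ) (a' b' : Fin N → Fin d → ℝ),
      (∀ i, (univ.pi fun j => Icc (a' i j) (b' i j)) ⊆ univ.pi fun _ => Icc (0 : ℝ) 1) ∧
      ∀ a b : Fin d → ℝ,
        (univ.pi fun j => Icc (a j) (b j)) ⊆ (univ.pi fun _ => Icc (0 : ℝ) 1) →
        ∃ i, (μ (symmDiff (univ.pi fun j => Icc (a j) (b j))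
          (univ.pi fun j => Icc (a' i j) (b' i j)))).toReal < ε := by
  intro ε hε
  set δ : ℝ := ε / (8 * C * (d + 1)) with hδ_def
  have hδ : 0 < δ := by positivity
  have hsmall : C * (8 * d * δ) < ε := by
    have : C * (8 * (d + 1) * δ) = ε := by rw [hδ_def]; field_simp
    nlinarith [mul_pos hC hδ]
  have hcompact : IsCompact (Icc (0 : Fin d → ℝ) 1 ×ˢ Icc (0 : Fin d → ℝ) 1) :=
    isCompact_Icc.prod isCompact_Icc
  obtain ⟨t, hts, htfin, hcover⟩ := hcompact.finite_cover_balls hδ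
  obtain ⟨N, f, hf⟩ := htfin.fin_embedding
  have hbox : ∀ i, (univ.pi fun j => Icc ((f i).1 j) ((f i).2 j)) ⊆
      univ.pi fun _ => Icc (0 : ℝ) 1 := fun i => by
    have hi := hts (hf ▸ mem_range_self i)
    exact pi_Icc_subset_unitCube hi.1.1 hi.2.2
  refine ⟨N, fun i => (f i).1, fun i => (f i).2, hbox, fun a b hab => ?_⟩
  obtain ⟨a₁, ha₁, b₁, hb₁, heq⟩ := exists_endpoints_mem_Icc hab
  rw [heq] at hab ⊢
  obtain ⟨p, hp, hdist⟩ := mem_iUnion₂.1 (hcover (mk_mem_prod ha₁ hb₁))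
  obtain ⟨i, rfl⟩ := hf.symm ▸ hp
  refine ⟨i, ?_⟩
  obtain ⟨hda, hdb⟩ := max_lt_iff.1 (Metric.mem_ball.1 hdist)
  have hvol := volume_symmDiff_pi_Icc_le hδ.le hab (hbox i)
    (fun j => (dist_le_pi_dist a₁ (f i).1 j).trans hda.le)
    (fun j => (dist_le_pi_dist b₁ (f i).2 j).trans hdb.le)
  have hmeas : ∀ c e : Fin d → ℝ, MeasurableSet (univ.pi fun j => Icc (c j) (e j)) :=
    fun c e => MeasurableSet.univ_pi fun _ => measurableSet_Icc
  have hμ := (hdom _ ((hmeas a₁ b₁).symmDiff (hmeas (f i).1 (f i).2))).trans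
    (mul_le_mul_right hvol _)
  rw [← ENNReal.ofReal_mul hC.le] at hμ
  exact (ENNReal.toReal_le_of_le_ofReal (by positivity) hμ).trans_lt hsmall
end

section
/- Let (Ω₁, ℱ₁, P₁) and (Ω₂, ℱ₂, P₂) be probability spaces. Let g_m : Ω₁ → ℝ be measurable with P₁({ω₁ : g_m(ω₁) ≤ t₁}) → c₁ as m → ∞, and let f_m : Ω₁ × Ω₂ → ℝ be measurable with respect to the product σ-algebra such that for P₁-almost every ω₁, ∫_{Ω₂} 1{f_m(ω₁, ω₂) ≤ t₂} dP₂(ω₂) → c₂ as m → ∞. Then (P₁ ⊗ P₂)({(ω₁, ω₂) : g_m(ω₁) ≤ t₁ and f_m(ω₁, ω₂) ≤ t₂}) → c₁·c₂ as m → ∞. -/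
open MeasureTheory Filter

/-- The measure of the part of a measurable set `s` lying over `A` is the integral over `A` of the
measures of the sections of `s`. -/
theorem toReal_prod_fst_mem_and_mem {Ω₁ Ω₂ : Type*} [MeasurableSpace Ω₁] [MeasurableSpace Ω₂]
    (P₁ : Measure Ω₁) (P₂ : Measure Ω₂) [IsFiniteMeasure P₁] [IsFiniteMeasure P₂]
    (A : Set Ω₁) {s : Set (Ω₁ × Ω₂)} (hs : MeasurableSet s) :
    ((P₁.prod P₂) {p | p.1 ∈ A ∧ p ∈ s}).toReal =
      ∫ ω in A, (P₂ (Prod.mk ω ⁻¹' s)).toReal ∂P₁ := by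
  have hset : {p : Ω₁ × Ω₂ | p.1 ∈ A ∧ p ∈ s} = s ∩ A ×ˢ Set.univ := by
    ext p
    simp [and_comm]
  rw [hset, ← Measure.restrict_apply hs, ← Measure.prod_restrict, Measure.restrict_univ,
    Measure.prod_apply hs, integral_toReal (measurable_measure_prodMk_left hs).aemeasurable
      (ae_of_all _ fun _ => measure_lt_top _ _)]

/-- If uniformly bounded functions converge almost everywhere to a constant `c`, their integrals
over sets whose measures converge to `a` converge to `a * c`. -/
theorem tendsto_setIntegral_of_tendsto_const {Ω : Type*} [MeasurableSpace Ω]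
    (P : Measure Ω) [IsFiniteMeasure P] {A : ℕ → Set Ω} (hA : ∀ m, MeasurableSet (A m))
    {h : ℕ → Ω → ℝ} (hh : ∀ m, AEStronglyMeasurable (h m) P) {C : ℝ}
    (hC : ∀ m ω, ‖h m ω‖ ≤ C) {a c : ℝ}
    (hAconv : Tendsto (fun m => (P (A m)).toReal) atTop (nhds a))
    (hconv : ∀ᵐ ω ∂P, Tendsto (fun m => h m ω) atTop (nhds c)) :
    Tendsto (fun m => ∫ ω in A m, h m ω ∂P) atTop (nhds (a * c)) := by
  have hint : ∀ m, Integrable (h m) P := fun m => .of_bound (hh m) C (ae_of_all _ (hC m))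
  have hdiff : Tendsto (fun m => ∫ ω in A m, (h m ω - c) ∂P) atTop (nhds 0) := by
    simp_rw [← integral_indicator (hA _)]
    rw [← integral_zero Ω ℝ (μ := P)]
    refine tendsto_integral_of_dominated_convergence (fun _ => C + ‖c‖)
      (fun m => ((hh m).sub aestronglyMeasurable_const).indicator (hA m))
      (integrable_const _) (fun m => ae_of_all _ fun ω => ?_) ?_
    · exact (norm_indicator_le_norm_self _ _).trans
        ((norm_sub_le _ _).trans (by gcongr; exact hC m ω))
    · filter_upwards [hconv] with ω hω
      have hω' : Tendsto (fun m => ‖h m ω - c‖) atTop (nhds 0) := by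
        simpa using (hω.sub_const c).norm
      exact squeeze_zero_norm (fun m => norm_indicator_le_norm_self _ _) hω'
  have hsum := hdiff.add (hAconv.mul_const c)
  rw [zero_add] at hsum
  refine hsum.congr fun m => ?_
  rw [integral_sub (hint m).integrableOn (integrable_const c)]
  simp [Measure.real]

/-- Asymptotic-independence lemma (structure of the proof of Theorem 3.3): the
joint probability of a first-wave event and a second-wave event whose
conditional probability converges a.s. factors into the product of the limits. -/
theorem prod_prob_tendsto_mul
    {Ω₁ Ω₂ : Type*} [MeasurableSpace Ω₁] [MeasurableSpace Ω₂]
    (P₁ : Measure Ω₁) (P₂ : Measure Ω₂)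
    [IsProbabilityMeasure P₁] [IsProbabilityMeasure P₂]
    (g : ℕ → Ω₁ → ℝ) (hg : ∀ m, Measurable (g m))
    (f : ℕ → Ω₁ × Ω₂ → ℝ) (hf : ∀ m, Measurable (f m))
    (t₁ t₂ c₁ c₂ : ℝ)
    (hgconv : Tendsto (fun m => (P₁ {ω₁ | g m ω₁ ≤ t₁}).toReal) atTop (nhds c₁))
    (hfconv : ∀ᵐ ω₁ ∂P₁,
      Tendsto (fun m => (P₂ {ω₂ | f m (ω₁, ω₂) ≤ t₂}).toReal) atTop (nhds c₂)) :
    Tendsto (fun m => ((P₁.prod P₂) {p | g m p.1 ≤ t₁ ∧ f m p ≤ t₂}).toReal)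
      atTop (nhds (c₁ * c₂)) := by
  have hs : ∀ m, MeasurableSet {p | f m p ≤ t₂} := fun m =>
    measurableSet_le (hf m) measurable_const
  have hA : ∀ m, MeasurableSet {ω₁ | g m ω₁ ≤ t₁} := fun m =>
    measurableSet_le (hg m) measurable_const
  refine (tendsto_setIntegral_of_tendsto_const P₁ hA (C := 1)
    (fun m => (measurable_measure_prodMk_left (hs m)).ennreal_toReal.aestronglyMeasurable)
    (fun m ω => ?_) hgconv hfconv).congr
    fun m => (toReal_prod_fst_mem_and_mem P₁ P₂ _ (hs m)).symm
  rw [Real.norm_of_nonneg ENNReal.toReal_nonneg]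
  exact measureReal_le_one
end
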